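/- arXiv:1206.5467 — 3 statements merged into one kernel-verified Lean document; each statement's English description precedes it below -/
import Mathlib

section
/- Let D be a finite oriented graph and let v₀ be a vertex of D that is adjacent (joined by an arc in one direction or the other) to every other vertex of D. If v₀ has minimum out-degree in D, i.e. d⁺(v₀) = δ⁺(D), then there exist δ⁺(D) pairwise arc-disjoint directed cycles each of which passes through v₀. -/
/-- `c` is a directed cycle of the digraph with arc relation `A`:
a list of pairwise distinct vertices, of length at least 3, with consecutive
arcs present and a closing arc from the last vertex back to the first. -/
def IsCycle {V : Type*} (A : V → V → Prop) (c : List V) : Prop :=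
  c.Nodup ∧ 3 ≤ c.length ∧ List.Chain' A c ∧
    ∀ h : c ≠ [], A (c.getLast h) (c.head h)

/-- The set of arcs of the cycle given by the list `c`. -/
def cycleArcs {V : Type*} [DecidableEq V] (c : List V) : Finset (V × V) :=
  (c.zip (c.rotate 1)).toFinset

/-- The out-degree of a vertex. -/
def outDeg {V : Type*} [Fintype V] (A : V → V → Prop) [DecidableRel A] (v : V) : ℕ :=
  (Finset.univ.filter (fun u => A v u)).card

/-- The arcs of the closed walk that starts at `a`, runs through `l` and returns to `a`. -/
def closedWalkArcs {V : Type*} (a : V) (l : List V) : List (V × V) :=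
  (a :: l).zip (l ++ [a])

theorem isChain_cons_append_singleton_iff {V : Type*} (R : V → V → Prop) (a b : V) (l : List V) :
    List.IsChain R (a :: (l ++ [b])) ↔ ∀ p ∈ (a :: l).zip (l ++ [b]), R p.1 p.2 := by
  induction l generalizing a with
  | nil => simp
  | cons c l ih =>
    rw [List.cons_append, List.isChain_cons_cons, ih, List.zip_cons_cons]
    simp

theorem exists_nodup_isChain_of_reflTransGen {V : Type*} {R : V → V → Prop} {u v : V}
    (h : Relation.ReflTransGen R u v) :
    ∃ l : List V, (u :: l).Nodup ∧ List.IsChain R (u :: l) ∧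
      (u :: l).getLast (List.cons_ne_nil u l) = v := by
  induction h using Relation.ReflTransGen.head_induction_on with
  | refl => exact ⟨[], by simp⟩
  | @head a c hac _ ih =>
    obtain ⟨l, hnd, hch, hlast⟩ := ih
    by_cases ha : a ∈ c :: l
    · obtain ⟨s, t, hst⟩ := List.append_of_mem ha
      have hsuf : (a :: t) <:+ (c :: l) := ⟨s, hst.symm⟩
      refine ⟨t, hnd.sublist hsuf.sublist, hch.suffix hsuf, ?_⟩
      rw [← hlast]
      simp [hst]
    · exact ⟨c :: l, List.nodup_cons.2 ⟨ha, hnd⟩, List.isChain_cons_cons.2 ⟨hac, hch⟩, by simpa⟩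

theorem exists_nodup_closedWalkArcs {V : Type*} {R : V → V → Prop} {u v : V}
    (hvu : R v u) (h : Relation.ReflTransGen R u v) :
    ∃ l : List V, (v :: l).Nodup ∧ ∀ p ∈ closedWalkArcs v l, R p.1 p.2 := by
  obtain ⟨l, hnd, hch, hlast⟩ := exists_nodup_isChain_of_reflTransGen h
  have hdrop := List.dropLast_append_getLast (List.cons_ne_nil u l)
  rw [hlast] at hdrop
  refine ⟨(u :: l).dropLast, ?_, ?_⟩
  · rw [← hdrop] at hnd
    exact (List.perm_append_singleton _ _).nodup_iff.1 hnd
  · refine (isChain_cons_append_singleton_iff R v v _).1 ?_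
    rw [hdrop]
    exact List.isChain_cons_cons.2 ⟨hvu, hch⟩

theorem map_fst_closedWalkArcs {V : Type*} (a : V) (l : List V) :
    (closedWalkArcs a l).map Prod.fst = a :: l := by
  simp [closedWalkArcs, List.map_fst_zip]

theorem map_snd_closedWalkArcs {V : Type*} (a : V) (l : List V) :
    (closedWalkArcs a l).map Prod.snd = l ++ [a] := by
  simp [closedWalkArcs, List.map_snd_zip]

/-- The unit circulation along a closed walk. -/
def closedWalkFlow {V : Type*} [DecidableEq V] (a : V) (l : List V) (x y : V) : ℤ :=
  (closedWalkArcs a l).count (x, y) - (closedWalkArcs a l).count (y, x)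

theorem closedWalkFlow_antisymm {V : Type*} [DecidableEq V] (a : V) (l : List V) (x y : V) :
    closedWalkFlow a l x y = -closedWalkFlow a l y x := by
  simp [closedWalkFlow]

theorem sum_count_fst {V : Type*} [Fintype V] [DecidableEq V] (W : List (V × V)) (x : V) :
    ∑ y, W.count (x, y) = (W.map Prod.fst).count x := by
  induction W with
  | nil => simp
  | cons p W ih =>
    obtain ⟨a, b⟩ := p
    simp only [List.count_cons, Finset.sum_add_distrib, ih, List.map_cons]
    by_cases h : a = x <;> simp [h]

theorem sum_count_snd {V : Type*} [Fintype V] [DecidableEq V] (W : List (V × V)) (x : V) :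
    ∑ y, W.count (y, x) = (W.map Prod.snd).count x := by
  induction W with
  | nil => simp
  | cons p W ih =>
    obtain ⟨a, b⟩ := p
    simp only [List.count_cons, Finset.sum_add_distrib, ih, List.map_cons]
    by_cases h : b = x <;> simp [h]

theorem sum_closedWalkFlow {V : Type*} [Fintype V] [DecidableEq V] (a : V) (l : List V) (x : V) :
    ∑ y, closedWalkFlow a l x y = 0 := by
  simp only [closedWalkFlow, Finset.sum_sub_distrib, ← Nat.cast_sum]
  rw [sum_count_fst, sum_count_snd, map_fst_closedWalkArcs, map_snd_closedWalkArcs,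
    (List.perm_append_singleton a l).count_eq, sub_self]

theorem nodup_closedWalkArcs {V : Type*} {a : V} {l : List V} (h : (a :: l).Nodup) :
    (closedWalkArcs a l).Nodup := by
  rw [← map_fst_closedWalkArcs] at h
  exact h.of_map

theorem closedWalkFlow_eq {V : Type*} [DecidableEq V] {a : V} {l : List V}
    (h : (a :: l).Nodup) (x y : V) :
    closedWalkFlow a l x y = (if (x, y) ∈ closedWalkArcs a l then 1 else 0) -
      (if (y, x) ∈ closedWalkArcs a l then 1 else 0) := by
  simp only [closedWalkFlow, (nodup_closedWalkArcs h).count]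
  push_cast
  rfl

theorem exists_mem_closedWalkArcs_iff {V : Type*} {a : V} {l : List V} (h : (a :: l).Nodup) :
    ∃ u, ∀ y, (a, y) ∈ closedWalkArcs a l ↔ y = u := by
  have hfst : (a, (l ++ [a]).head (by simp)) ∈ closedWalkArcs a l := by
    cases l <;> simp [closedWalkArcs]
  refine ⟨_, fun y => ⟨fun hy => ?_, fun hy => hy ▸ hfst⟩⟩
  rw [← map_fst_closedWalkArcs] at h
  exact (Prod.ext_iff.1 (List.inj_on_of_nodup_map h hy hfst rfl)).2

theorem cycleArcs_cons {V : Type*} [DecidableEq V] (a : V) (l : List V) :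
    cycleArcs (a :: l) = (closedWalkArcs a l).toFinset := by
  simp [cycleArcs, closedWalkArcs]

/-- An integral circulation on `V`, recorded by its net flow on ordered pairs. -/
def IsCirculation {V : Type*} [Fintype V] (g : V → V → ℤ) : Prop :=
  (∀ x y, g x y = -g y x) ∧ ∀ x, ∑ y, g x y = 0

theorem IsCirculation.add_closedWalkFlow {V : Type*} [Fintype V] [DecidableEq V] {g : V → V → ℤ}
    (hg : IsCirculation g) (a : V) (l : List V) :
    IsCirculation (fun x y => g x y + closedWalkFlow a l x y) := by
  refine ⟨fun x y => ?_, fun x => ?_⟩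
  · simp only [hg.1 x y, closedWalkFlow_antisymm a l x y]; ring
  · rw [Finset.sum_add_distrib, hg.2, sum_closedWalkFlow, add_zero]

theorem IsCirculation.sub_closedWalkFlow {V : Type*} [Fintype V] [DecidableEq V] {g : V → V → ℤ}
    (hg : IsCirculation g) (a : V) (l : List V) :
    IsCirculation (fun x y => g x y - closedWalkFlow a l x y) := by
  refine ⟨fun x y => ?_, fun x => ?_⟩
  · simp only [hg.1 x y, closedWalkFlow_antisymm a l x y]; ring
  · rw [Finset.sum_sub_distrib, hg.2, sum_closedWalkFlow, sub_zero]

/-- The net flow of a circulation across a cut vanishes. -/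
theorem IsCirculation.sum_cut {V : Type*} [Fintype V] [DecidableEq V] {g : V → V → ℤ}
    (hg : IsCirculation g) (S : Finset V) : ∑ x ∈ S, ∑ y ∈ Sᶜ, g x y = 0 := by
  have h1 : ∑ x ∈ S, ∑ y ∈ S, g x y = 0 := by
    have h : ∑ x ∈ S, ∑ y ∈ S, g x y = -∑ x ∈ S, ∑ y ∈ S, g x y := by
      conv_lhs => rw [Finset.sum_comm]
      simp only [← Finset.sum_neg_distrib]
      exact Finset.sum_congr rfl fun x _ => Finset.sum_congr rfl fun y _ => hg.1 y x
    linarith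
  have h2 : ∑ x ∈ S, (∑ y ∈ S, g x y + ∑ y ∈ Sᶜ, g x y) = 0 :=
    Finset.sum_eq_zero fun x _ => by rw [Finset.sum_add_sum_compl, hg.2]
  rw [Finset.sum_add_distrib, h1, zero_add] at h2
  exact h2

/-- A circulation with values at most `1` decomposes, as far as the arcs leaving `v` are
concerned, into arc-disjoint cycles through `v`. -/
theorem IsCirculation.exists_arc_disjoint_cycles {V : Type*} [Fintype V] [DecidableEq V] (v : V)
    (k : ℕ) (g : V → V → ℤ) (hg : IsCirculation g) (hle : ∀ x y, g x y ≤ 1)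
    (hk : (Finset.univ.filter fun y => g v y = 1).card = k) :
    ∃ L : Fin k → List V,
      (∀ i, (v :: L i).Nodup ∧ ∀ p ∈ closedWalkArcs v (L i), g p.1 p.2 = 1) ∧
      ∀ i j, i ≠ j → List.Disjoint (closedWalkArcs v (L i)) (closedWalkArcs v (L j)) := by
  classical
  induction k generalizing g with
  | zero => exact ⟨fun _ => [], fun i => i.elim0, fun i => i.elim0⟩
  | succ k ih =>
    obtain ⟨u, hu⟩ : (Finset.univ.filter fun y => g v y = 1).Nonempty := by
      rw [← Finset.card_pos]; omega
    replace hu : g v u = 1 := by simpa using hu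
    have hreach : Relation.ReflTransGen (fun x y => g x y = 1) u v := by
      by_contra hv
      let S := Finset.univ.filter fun x => Relation.ReflTransGen (fun x y => g x y = 1) u x
      have huS : u ∈ S := by simp [S, Relation.ReflTransGen.refl]
      have hvS : v ∈ Sᶜ := by simpa [S] using hv
      have hnonpos : ∀ x ∈ S, ∀ y ∈ Sᶜ, g x y ≤ 0 := by
        intro x hx y hy
        simp only [S, Finset.mem_compl, Finset.mem_filter, Finset.mem_univ, true_and] at hx hy
        have h1 : g x y ≠ 1 := fun h => hy (hx.tail h)
        have := hle x y
        omega
      have hlt : ∑ x ∈ S, ∑ y ∈ Sᶜ, g x y < ∑ x ∈ S, (0 : ℤ) := by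
        refine Finset.sum_lt_sum (fun x hx => Finset.sum_nonpos (hnonpos x hx)) ⟨u, huS, ?_⟩
        calc ∑ y ∈ Sᶜ, g u y < ∑ y ∈ Sᶜ, (0 : ℤ) :=
              Finset.sum_lt_sum (hnonpos u huS) ⟨v, hvS, by rw [hg.1, hu]; norm_num⟩
          _ = 0 := by simp
      rw [hg.sum_cut S] at hlt
      simp at hlt
    obtain ⟨l, hnd, hl⟩ := exists_nodup_closedWalkArcs (R := fun x y => g x y = 1) hu hreach
    obtain ⟨w, hw⟩ := exists_mem_closedWalkArcs_iff hnd
    have hflow := closedWalkFlow_eq hnd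
    have hval : ∀ x y, g x y - closedWalkFlow v l x y ≤ 1 ∧
        (g x y - closedWalkFlow v l x y = 1 ↔ g x y = 1 ∧ (x, y) ∉ closedWalkArcs v l) := by
      intro x y
      have h1 := hl (x, y)
      have h2 := hl (y, x)
      have h3 := hg.1 x y
      have h4 := hle x y
      rw [hflow]
      split_ifs <;> simp_all
    have hcard : (Finset.univ.filter fun y => g v y - closedWalkFlow v l v y = 1).card = k := by
      have : (Finset.univ.filter fun y => g v y - closedWalkFlow v l v y = 1) =
          (Finset.univ.filter fun y => g v y = 1).erase w := by
        ext y
        simp [(hval v y).2, hw, and_comm]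
      rw [this, Finset.card_erase_of_mem, hk, Nat.add_sub_cancel]
      simpa using hl _ ((hw w).2 rfl)
    obtain ⟨L, hL, hdisj⟩ := ih _ (hg.sub_closedWalkFlow v l) (fun x y => (hval x y).1) hcard
    have hdisj' : ∀ i, List.Disjoint (closedWalkArcs v l) (closedWalkArcs v (L i)) :=
      fun i p hp hp' => ((hval p.1 p.2).2.1 ((hL i).2 p hp')).2 hp
    refine ⟨Fin.cons l L, Fin.cases ⟨hnd, hl⟩ fun i =>
      ⟨(hL i).1, fun p hp => ((hval p.1 p.2).2.1 ((hL i).2 p hp)).1⟩, ?_⟩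
    · refine Fin.cases (Fin.cases (by simp) fun j _ => hdisj' j) fun i => ?_
      exact Fin.cases (fun _ => (hdisj' i).symm) fun j hij => hdisj i j fun h => hij (h ▸ rfl)

/-- If no set `S` avoiding `v` and meeting `N⁺(v)` sends out fewer arcs than it receives from `v`,
then some circulation saturates all arcs leaving `v`. -/
theorem exists_saturating_circulation {V : Type*} [Fintype V] [DecidableEq V] (v : V)
    (c : V → V → ℤ) (hc0 : ∀ x y, 0 ≤ c x y) (hc1 : ∀ x y, c x y + c y x ≤ 1)
    (hcut : ∀ S : Finset V, v ∉ S → (∃ u ∈ S, c v u = 1) →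
      ∑ x ∈ S, c v x ≤ ∑ x ∈ S, ∑ y ∈ Sᶜ, c x y) :
    ∃ g, IsCirculation g ∧ (∀ x y, g x y ≤ c x y) ∧ ∀ u, c v u = 1 → g v u = 1 := by
  classical
  suffices H : ∀ n : ℕ, ∀ g, IsCirculation g → (∀ x y, g x y ≤ c x y) →
      (Finset.univ.filter fun u => c v u = 1 ∧ g v u ≠ 1).card = n →
      ∃ g, IsCirculation g ∧ (∀ x y, g x y ≤ c x y) ∧ ∀ u, c v u = 1 → g v u = 1 from
    H _ (fun _ _ => 0) ⟨by simp, by simp⟩ hc0 rfl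
  intro n
  induction n using Nat.strong_induction_on with
  | _ n ih =>
  intro g hg hle hn
  by_cases hall : ∀ u, c v u = 1 → g v u = 1
  · exact ⟨g, hg, hle, hall⟩
  push Not at hall
  obtain ⟨u, hcu, hgu⟩ := hall
  have huv := hc1 u v
  have hgu0 : g v u = 0 := by
    have := hg.1 u v
    have := hle u v
    have := hle v u
    have := hc0 u v
    omega
  let R : V → V → Prop := fun x y => g x y < c x y ∧ (x = v → y = u) ∧ (y = v → g v x ≠ 1)
  have hvu_ne : u ≠ v := by
    rintro rfl
    omega
  have hRvu : R v u := ⟨by omega, fun _ => rfl, fun h => absurd h hvu_ne⟩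
  have hreach : Relation.ReflTransGen R u v := by
    by_contra hv
    let S := Finset.univ.filter fun x => Relation.ReflTransGen R u x
    have huS : u ∈ S := by simp [S, Relation.ReflTransGen.refl]
    have hvS : v ∉ S := by simpa [S] using hv
    have hpt : ∀ x ∈ S, ∀ y ∈ Sᶜ, c x y - (if y = v then c v x else 0) ≤ g x y ∧
        (x = u → y = v → c x y - (if y = v then c v x else 0) < g x y) := by
      intro x hx y hy
      have hxv : x ≠ v := fun h => hvS (h ▸ hx)
      simp only [S, Finset.mem_compl, Finset.mem_filter, Finset.mem_univ, true_and] at hx hy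
      have hR : ¬ R x y := fun h => hy (hx.tail h)
      simp only [R, not_and, hxv, false_implies, true_implies] at hR
      have := hg.1 x y
      have := hle x y
      have := hle y x
      have := hc1 x y
      have := hc0 x y
      have := hc0 y x
      by_cases hyv : y = v
      · subst hyv
        simp only [if_true, true_implies, not_not, ne_eq] at hR ⊢
        constructor
        · by_contra hcon
          have := hR (by omega)
          omega
        · rintro rfl
          omega
      · simp only [hyv, if_false, sub_zero, false_implies, implies_true, and_true]
        by_contra hcon
        exact hR (by omega) fun h => absurd h hyv
    have hlt : ∑ x ∈ S, ∑ y ∈ Sᶜ, (c x y - (if y = v then c v x else 0)) <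
        ∑ x ∈ S, ∑ y ∈ Sᶜ, g x y :=
      Finset.sum_lt_sum (fun x hx => Finset.sum_le_sum fun y hy => (hpt x hx y hy).1)
        ⟨u, huS, Finset.sum_lt_sum (fun y hy => (hpt u huS y hy).1)
          ⟨v, Finset.mem_compl.2 hvS, (hpt u huS v (Finset.mem_compl.2 hvS)).2 rfl rfl⟩⟩
    rw [hg.sum_cut S] at hlt
    simp only [Finset.sum_sub_distrib, Finset.sum_ite_eq', Finset.mem_compl, hvS,
      not_false_eq_true, if_true] at hlt
    have := hcut S hvS ⟨u, huS, hcu⟩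
    omega
  obtain ⟨l, hnd, hl⟩ := exists_nodup_closedWalkArcs hRvu hreach
  have hflow := closedWalkFlow_eq hnd
  have hnot : ∀ y, g v y = 1 → (y, v) ∉ closedWalkArcs v l :=
    fun y hy hmem => (hl _ hmem).2.2 rfl hy
  refine ih _ ?_ _ (hg.add_closedWalkFlow v l) (fun x y => ?_) rfl
  · rw [← hn]
    refine Finset.card_lt_card ((Finset.ssubset_iff_of_subset fun y => ?_).2 ⟨u, ?_, ?_⟩)
    · simp only [Finset.mem_filter, Finset.mem_univ, true_and]
      rintro ⟨hcy, hgy⟩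
      refine ⟨hcy, fun h => hgy ?_⟩
      have h1 : (v, y) ∉ closedWalkArcs v l := fun hmem => by
        have := (hl _ hmem).1
        simp only at this
        omega
      rw [hflow, if_neg h1, if_neg (hnot y h), h]
      norm_num
    · simp [hcu, hgu]
    · obtain ⟨w, hw⟩ := exists_mem_closedWalkArcs_iff hnd
      have hwu : w = u := (hl _ ((hw w).2 rfl)).2.1 rfl
      have h1 : (u, v) ∉ closedWalkArcs v l := fun hmem => by
        have := (hl _ hmem).1
        have := hg.1 u v
        have := hc0 u v
        simp only at *
        omega
      have h2 : (v, u) ∈ closedWalkArcs v l := (hw u).2 hwu.symm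
      simp [hflow, h1, h2, hgu0]
  · have h1 := fun h => (hl (x, y) h).1
    have h2 := hle x y
    rw [hflow]
    simp only at h1
    split_ifs with h3 h4 <;> first | omega | (have := h1 h3; omega)

/-- The cut condition at a vertex of minimum out-degree adjacent to all other vertices. -/
theorem sum_le_sum_cut_of_min_outdegree {V : Type*} [Fintype V] [DecidableEq V] (v : V)
    (c : V → V → ℤ) (hc0 : ∀ x y, 0 ≤ c x y) (hc1 : ∀ x y, c x y + c y x ≤ 1)
    (hadj : ∀ x, x ≠ v → c v x + c x v = 1) (hmin : ∀ x, ∑ y, c v y ≤ ∑ y, c x y)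
    (S : Finset V) (hvS : v ∉ S) :
    ∑ x ∈ S, c v x ≤ ∑ x ∈ S, ∑ y ∈ Sᶜ, c x y := by
  set d := ∑ y, c v y
  set X := ∑ x ∈ S, c v x
  set E := ∑ x ∈ S, ∑ y ∈ Sᶜ, c x y
  have hXd : X ≤ d :=
    Finset.sum_le_sum_of_subset_of_nonneg (Finset.subset_univ S) fun y _ _ => hc0 v y
  have hYE : ∑ x ∈ S, c x v ≤ E := Finset.sum_le_sum fun x _ =>
    Finset.single_le_sum (f := fun y => c x y) (fun y _ => hc0 x y) (Finset.mem_compl.2 hvS)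
  have hXY : X + ∑ x ∈ S, c x v = S.card := by
    rw [← Finset.sum_add_distrib, Finset.card_eq_sum_ones, Nat.cast_sum]
    exact Finset.sum_congr rfl fun x hx => by simpa using hadj x fun h => hvS (h ▸ hx)
  have hout : S.card * d ≤ ∑ x ∈ S, ∑ y ∈ S, c x y + E := by
    rw [← Finset.sum_add_distrib, ← nsmul_eq_mul]
    refine Finset.card_nsmul_le_sum _ _ _ fun x _ => ?_
    rw [Finset.sum_add_sum_compl]
    exact hmin x
  have hin : 2 * ∑ x ∈ S, ∑ y ∈ S, c x y ≤ (S.card : ℤ) * S.card - S.card := by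
    have h1 : 2 * ∑ x ∈ S, ∑ y ∈ S, c x y = ∑ x ∈ S, ∑ y ∈ S, (c x y + c y x) := by
      simp only [Finset.sum_add_distrib]
      rw [Finset.sum_comm (f := fun x y => c y x)]
      ring
    have h2 : ∑ x ∈ S, ∑ y ∈ S, (c x y + c y x) ≤
        ∑ x ∈ S, ∑ y ∈ S, (1 - if x = y then (1 : ℤ) else 0) := by
      refine Finset.sum_le_sum fun x _ => Finset.sum_le_sum fun y _ => ?_
      have := hc1 x y
      split_ifs with h
      · subst h
        omega
      · omega
    rw [h1]
    refine h2.trans (le_of_eq ?_)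
    simp [Finset.sum_sub_distrib]
  have hY0 : 0 ≤ ∑ x ∈ S, c x v := Finset.sum_nonneg fun x _ => hc0 x v
  by_contra! hlt
  have hm : (S.card : ℤ) ≤ 2 * d - 1 := by omega
  have hm0 : (0 : ℤ) ≤ S.card := Nat.cast_nonneg _
  nlinarith [mul_nonneg hm0 (sub_nonneg.2 hm)]

theorem isCycle_of_closedWalkArcs {V : Type*} {A : V → V → Prop} (hirr : ∀ x, ¬ A x x)
    (hasym : ∀ x y, A x y → ¬ A y x) {v : V} {l : List V} (hnd : (v :: l).Nodup)
    (harc : ∀ p ∈ closedWalkArcs v l, A p.1 p.2) : IsCycle A (v :: l) := by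
  have hch := (isChain_cons_append_singleton_iff A v v l).2 harc
  rw [← List.cons_append, List.isChain_append] at hch
  obtain ⟨hch, -, hclose⟩ := hch
  refine ⟨hnd, ?_, hch, fun h => hclose _ (List.getLast_mem_getLast? h) _ (by simp)⟩
  match l, harc with
  | [], harc => exact absurd (harc (v, v) (by simp [closedWalkArcs])) (hirr v)
  | [a], harc =>
    exact absurd (harc (a, v) (by simp [closedWalkArcs]))
      (hasym v a (harc (v, a) (by simp [closedWalkArcs])))
  | _ :: _ :: _, _ => simp

/-- In a finite oriented graph, a vertex `v₀` of minimum out-degree which is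
adjacent to all other vertices belongs to `δ⁺(D)` arc-disjoint cycles. -/
theorem min_outdegree_vertex_arc_disjoint_cycles {V : Type*} [Fintype V] [DecidableEq V]
    (A : V → V → Prop) [DecidableRel A]
    (hirr : ∀ x, ¬ A x x)
    (hasym : ∀ x y, A x y → ¬ A y x)
    (v0 : V)
    (hadj : ∀ u, u ≠ v0 → A v0 u ∨ A u v0)
    (hmin : ∀ v : V, outDeg A v0 ≤ outDeg A v) :
    ∃ C : Fin (outDeg A v0) → List V,
      (∀ i, IsCycle A (C i) ∧ v0 ∈ C i) ∧
      ∀ i j, i ≠ j → Disjoint (cycleArcs (C i)) (cycleArcs (C j)) := by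
  classical
  let c : V → V → ℤ := fun x y => if A x y then 1 else 0
  have hcA : ∀ x y, c x y = 1 ↔ A x y := fun x y => by simp [c]
  have hc0 : ∀ x y, 0 ≤ c x y := fun x y => by simp only [c]; split_ifs <;> simp
  have hc1 : ∀ x y, c x y + c y x ≤ 1 := fun x y => by
    have := hasym x y
    simp only [c]
    split_ifs <;> simp_all
  have hcadj : ∀ x, x ≠ v0 → c v0 x + c x v0 = 1 := fun x hx => by
    have h1 := hadj x hx
    have h2 := hasym v0 x
    simp only [c]
    split_ifs <;> simp_all
  have hdeg : ∀ x, ∑ y, c x y = outDeg A x := fun x => by simp [c, outDeg]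
  obtain ⟨g, hg, hle, hsat⟩ := exists_saturating_circulation v0 c hc0 hc1 fun S hS _ =>
    sum_le_sum_cut_of_min_outdegree v0 c hc0 hc1 hcadj
      (fun x => by rw [hdeg, hdeg]; exact_mod_cast hmin x) S hS
  have hle1 : ∀ x y, g x y ≤ 1 := fun x y => by
    have := hle x y
    have := hc1 x y
    have := hc0 y x
    omega
  have hgA : ∀ x y, g x y = 1 → A x y := fun x y h => by
    have := hle x y
    by_contra hn
    simp [c, hn, h] at this
  have hcard : (Finset.univ.filter fun y => g v0 y = 1).card = outDeg A v0 := by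
    unfold outDeg
    congr 1
    ext y
    simpa using ⟨hgA v0 y, fun h => hsat y ((hcA v0 y).2 h)⟩
  obtain ⟨L, hL, hdisj⟩ := hg.exists_arc_disjoint_cycles v0 _ g hle1 hcard
  refine ⟨fun i => v0 :: L i, fun i => ⟨?_, by simp⟩, fun i j hij => ?_⟩
  · obtain ⟨hnd, harc⟩ := hL i
    exact isCycle_of_closedWalkArcs hirr hasym hnd fun p hp => hgA _ _ (harc p hp)
  · rw [cycleArcs_cons, cycleArcs_cons, List.disjoint_toFinset_iff_disjoint]
    exact hdisj i j hij
end

section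
/- Let T be the tournament on the vertex set Fin 13 = {0,…,12} defined as follows: for i < j the arc goes from i to j, except for the pairs B = {(2,0),(4,2),(6,4),(8,6),(10,8),(12,10),(6,0),(8,2),(10,4),(12,6),(8,0),(12,4)}, for which the arc goes backward. Then ν(T) = 11: the eleven 3-cycles (0,1,2), (2,3,4), (4,5,6), (6,7,8), (8,9,10), (10,11,12), (0,3,6), (2,5,8), (4,7,10), (6,9,12), (0,4,8) are pairwise arc-disjoint directed cycles of T, and T contains no family of 12 pairwise arc-disjoint directed cycles. -/
/-- The backward arcs of the tournament `T` of Figure 1. -/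
def B13 : Finset (Fin 13 × Fin 13) :=
  {(2,0),(4,2),(6,4),(8,6),(10,8),(12,10),(6,0),(8,2),(10,4),(12,6),(8,0),(12,4)}

/-- The tournament `T` of Figure 1: for `i < j` the arc goes from `i` to `j`,
except for the pairs in `B13`, for which the arc goes backward. -/
def T13 (i j : Fin 13) : Prop :=
  (i < j ∧ (j, i) ∉ B13) ∨ (i, j) ∈ B13

/-- The family `𝒞` of eleven 3-cycles of `T`. -/
def C11 : Fin 11 → List (Fin 13) :=
  ![[0,1,2], [2,3,4], [4,5,6], [6,7,8], [8,9,10], [10,11,12],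
    [0,3,6], [2,5,8], [4,7,10], [6,9,12], [0,4,8]]

instance (i j : Fin 13) : Decidable (T13 i j) := by
  unfold T13; infer_instance

instance (c : List (Fin 13)) : Decidable (IsCycle T13 c) := by
  unfold IsCycle List.Chain'; infer_instance

theorem mem_cycleArcs_iff {V : Type*} [DecidableEq V] {l : List V} {p : V × V} :
    p ∈ cycleArcs l ↔ ∃ (i : ℕ) (h : i < l.length),
      p = (l[i], l[(i + 1) % l.length]'(Nat.mod_lt _ (Nat.zero_lt_of_lt h))) := by
  simp only [cycleArcs, List.mem_toFinset, List.mem_iff_getElem, List.getElem_zip,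
    List.getElem_rotate, List.length_zip, List.length_rotate, min_self]
  exact exists_congr fun i => exists_congr fun h => eq_comm

theorem exists_succ_mem_cycleArcs {V : Type*} [DecidableEq V] {c : List V} {x y : V}
    (h : (x, y) ∈ cycleArcs c) : ∃ z, (y, z) ∈ cycleArcs c := by
  obtain ⟨i, hi, hp⟩ := mem_cycleArcs_iff.1 h
  obtain ⟨-, rfl⟩ := Prod.mk.inj hp
  exact ⟨_, mem_cycleArcs_iff.2 ⟨_, Nat.mod_lt _ (by lia), rfl⟩⟩

theorem IsCycle.rel_of_mem_cycleArcs {V : Type*} [DecidableEq V] {A : V → V → Prop} {c : List V}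
    (hc : IsCycle A c) {x y : V} (h : (x, y) ∈ cycleArcs c) : A x y := by
  obtain ⟨-, hlen, hchain, hclose⟩ := hc
  obtain ⟨i, hi, hp⟩ := mem_cycleArcs_iff.1 h
  obtain ⟨rfl, rfl⟩ := Prod.mk.inj hp
  by_cases h1 : i + 1 < c.length
  · rw [getElem_congr_idx (Nat.mod_eq_of_lt h1)]
    exact List.isChain_iff_getElem.1 hchain i h1
  · have hn : i + 1 = c.length := by lia
    have hcl := hclose (List.ne_nil_of_length_pos (by lia))
    rw [List.getLast_eq_getElem, List.head_eq_getElem] at hcl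
    have hi1 : i = c.length - 1 := by lia
    have h0 : (i + 1) % c.length = 0 := by rw [hn, Nat.mod_self]
    rwa [getElem_congr_idx h0, getElem_congr_idx hi1]

theorem IsCycle.cycleArcs_nonempty {V : Type*} [DecidableEq V] {A : V → V → Prop} {c : List V}
    (hc : IsCycle A c) : (cycleArcs c).Nonempty :=
  ⟨_, mem_cycleArcs_iff.2 ⟨0, by have := hc.2.1; lia, rfl⟩⟩

/-- A finite arc set in which every arc can be continued cannot enter a set of vertices which
it leaves only by arcs ascending within that set. -/
theorem false_of_ascending {V : Type*} [LinearOrder V] [Finite V] {S : Finset (V × V)}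
    (hS : ∀ x y, (x, y) ∈ S → ∃ z, (y, z) ∈ S) {R : Finset V} {b a : V} (hba : (b, a) ∈ S)
    (ha : a ∈ R) (hR : ∀ x ∈ R, ∀ y, (x, y) ∈ S → x < y ∧ y ∈ R) : False := by
  have key : ∀ x : V, ∀ w, (w, x) ∈ S → x ∉ R := by
    intro x
    induction x using (Finite.to_wellFoundedGT (α := V)).wf.induction with
    | _ x ih =>
      intro w hw hx
      obtain ⟨z, hz⟩ := hS w x hw
      obtain ⟨hlt, hzR⟩ := hR x hx z hz
      exact ih z hlt x hz hzR
  exact key a b hba ha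

theorem IsCycle.exists_mem_B13 {c : List (Fin 13)} (hc : IsCycle T13 c) :
    ∃ p ∈ B13, p ∈ cycleArcs c := by
  by_contra! hno
  obtain ⟨⟨x, y⟩, hxy⟩ := hc.cycleArcs_nonempty
  refine false_of_ascending (R := Finset.univ) (fun _ _ => exists_succ_mem_cycleArcs) hxy
    (Finset.mem_univ _) fun u _ v huv => ⟨?_, Finset.mem_univ _⟩
  rcases hc.rel_of_mem_cycleArcs huv with h | h
  · exact h.1
  · exact absurd huv (hno _ h)

/-- `S` is closed under continuing arcs, consists of arcs of `T13`, and `e` is its only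
backward arc. -/
structure HasUniqueBackArc (S : Finset (Fin 13 × Fin 13)) (e : Fin 13 × Fin 13) : Prop where
  succ : ∀ x y, (x, y) ∈ S → ∃ z, (y, z) ∈ S
  rel : ∀ x y, (x, y) ∈ S → T13 x y
  mem : e ∈ S
  unique : ∀ p ∈ S, p ∈ B13 → p = e

/-- If every way to leave `R` by an arc outside `U` is along `f`, then `f` is used. -/
theorem HasUniqueBackArc.mem_of_cut {S : Finset (Fin 13 × Fin 13)} {e : Fin 13 × Fin 13}
    (hS : HasUniqueBackArc S e) {U : Finset (Fin 13 × Fin 13)} (hU : ∀ p ∈ U, p ∉ S)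
    (f : Fin 13 × Fin 13) (R : Finset (Fin 13))
    (hR : e.2 ∈ R ∧ ∀ x ∈ R, ∀ y, T13 x y → ((x, y) ∈ B13 → (x, y) = e) → (x, y) ∉ U →
      (x, y) = f ∨ (x < y ∧ y ∈ R)) : f ∈ S := by
  by_contra hf
  refine false_of_ascending hS.succ (b := e.1) (a := e.2) hS.mem hR.1 fun x hx y hxy => ?_
  rcases hR.2 x hx y (hS.rel x y hxy) (hS.unique _ hxy) (fun h => hU _ h hxy) with h | h
  · exact absurd (h ▸ hxy) hf
  · exact h

theorem exists_hasUniqueBackArc_of_packing {D : Fin 12 → List (Fin 13)}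
    (hD : ∀ i, IsCycle T13 (D i))
    (hdisj : ∀ i j, i ≠ j → Disjoint (cycleArcs (D i)) (cycleArcs (D j))) :
    ∃ S : Fin 13 × Fin 13 → Finset (Fin 13 × Fin 13),
      (∀ e ∈ B13, HasUniqueBackArc (S e) e) ∧
      ∀ e ∈ B13, ∀ e' ∈ B13, e ≠ e' → ∀ p ∈ S e, p ∉ S e' := by
  choose g hgB hgD using fun i => (hD i).exists_mem_B13
  have hinj : Function.Injective g := fun i j hij => by
    by_contra hne
    exact Finset.disjoint_left.1 (hdisj i j hne) (hgD i) (hij ▸ hgD j)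
  have himg : Finset.univ.image g = B13 := by
    refine Finset.eq_of_subset_of_card_le (fun p hp => ?_) ?_
    · obtain ⟨i, -, rfl⟩ := Finset.mem_image.1 hp
      exact hgB i
    · rw [Finset.card_image_of_injective _ hinj]
      decide
  have hsurj : ∀ e ∈ B13, ∃ i, g i = e := fun e he => by
    simpa [← himg] using he
  have hinv := Function.leftInverse_invFun hinj
  refine ⟨fun e => cycleArcs (D (Function.invFun g e)), fun e he => ?_, ?_⟩
  · obtain ⟨i, rfl⟩ := hsurj e he
    simp only [hinv i]
    refine ⟨fun _ _ => exists_succ_mem_cycleArcs, fun _ _ => (hD i).rel_of_mem_cycleArcs,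
      hgD i, fun p hp hpB => ?_⟩
    obtain ⟨j, rfl⟩ := hsurj p hpB
    by_contra hne
    exact Finset.disjoint_left.1 (hdisj i j fun h => hne (h ▸ rfl)) hp (hgD j)
  · intro e he e' he' hne p hp hp'
    obtain ⟨i, rfl⟩ := hsurj e he
    obtain ⟨j, rfl⟩ := hsurj e' he'
    simp only [hinv i] at hp
    simp only [hinv j] at hp'
    exact Finset.disjoint_left.1 (hdisj i j fun h => hne (h ▸ rfl)) hp hp'

/-- `ν(T) = 11`: the eleven listed 3-cycles are pairwise arc-disjoint directed
cycles of `T`, and `T` has no family of 12 pairwise arc-disjoint directed cycles. -/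
theorem nu_T13_eq_eleven :
    (∀ i, IsCycle T13 (C11 i)) ∧
    (∀ i j, i ≠ j → Disjoint (cycleArcs (C11 i)) (cycleArcs (C11 j))) ∧
    ¬ ∃ D : Fin 12 → List (Fin 13),
        (∀ i, IsCycle T13 (D i)) ∧
        ∀ i j, i ≠ j → Disjoint (cycleArcs (D i)) (cycleArcs (D j)) := by
  refine ⟨by decide +kernel, by decide +kernel, ?_⟩
  rintro ⟨D, hD, hdisj⟩
  obtain ⟨S, hS, hSd⟩ := exists_hasUniqueBackArc_of_packing hD hdisj
  have sep {e e' p : Fin 13 × Fin 13} (hp : p ∈ S e)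
      (h : e ∈ B13 ∧ e' ∈ B13 ∧ e ≠ e' := by decide) : p ∉ S e' :=
    hSd e h.1 e' h.2.1 h.2.2 p hp
  have a0 : (0, 1) ∈ S (2, 0) :=
    (hS _ (by decide)).mem_of_cut (U := ∅) (by simp) (0, 1)
      {x | x = 0 ∨ 2 < x} (by decide +kernel)
  have b0 : (1, 2) ∈ S (2, 0) :=
    (hS _ (by decide)).mem_of_cut (U := ∅) (by simp) (1, 2)
      {x | 0 ≤ x ∧ x ≠ 2} (by decide +kernel)
  have a2 : (2, 3) ∈ S (4, 2) :=
    (hS _ (by decide)).mem_of_cut (U := ∅) (by simp) (2, 3)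
      {x | x = 2 ∨ 4 < x} (by decide +kernel)
  have b2 : (3, 4) ∈ S (4, 2) :=
    (hS _ (by decide)).mem_of_cut (U := ∅) (by simp) (3, 4)
      {x | 2 ≤ x ∧ x ≠ 4} (by decide +kernel)
  have a4 : (4, 5) ∈ S (6, 4) :=
    (hS _ (by decide)).mem_of_cut (U := ∅) (by simp) (4, 5)
      {x | x = 4 ∨ 6 < x} (by decide +kernel)
  have b4 : (5, 6) ∈ S (6, 4) :=
    (hS _ (by decide)).mem_of_cut (U := ∅) (by simp) (5, 6)
      {x | 4 ≤ x ∧ x ≠ 6} (by decide +kernel)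
  have a6 : (6, 7) ∈ S (8, 6) :=
    (hS _ (by decide)).mem_of_cut (U := ∅) (by simp) (6, 7)
      {x | x = 6 ∨ 8 < x} (by decide +kernel)
  have b6 : (7, 8) ∈ S (8, 6) :=
    (hS _ (by decide)).mem_of_cut (U := ∅) (by simp) (7, 8)
      {x | 6 ≤ x ∧ x ≠ 8} (by decide +kernel)
  have a8 : (8, 9) ∈ S (10, 8) :=
    (hS _ (by decide)).mem_of_cut (U := ∅) (by simp) (8, 9)
      {x | x = 8 ∨ 10 < x} (by decide +kernel)
  have b8 : (9, 10) ∈ S (10, 8) :=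
    (hS _ (by decide)).mem_of_cut (U := ∅) (by simp) (9, 10)
      {x | 8 ≤ x ∧ x ≠ 10} (by decide +kernel)
  have a10 : (10, 11) ∈ S (12, 10) :=
    (hS _ (by decide)).mem_of_cut (U := ∅) (by simp) (10, 11)
      {x | x = 10 ∨ 12 < x} (by decide +kernel)
  have b10 : (11, 12) ∈ S (12, 10) :=
    (hS _ (by decide)).mem_of_cut (U := ∅) (by simp) (11, 12)
      {x | 10 ≤ x ∧ x ≠ 12} (by decide +kernel)
  have u0 : ∀ p ∈ ({(0, 1), (1, 2), (2, 3), (3, 4), (4, 5), (5, 6)} : Finset (Fin 13 × Fin 13)),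
      p ∉ S (6, 0) := by
    simp only [Finset.forall_mem_insert, Finset.mem_singleton, forall_eq]
    exact ⟨sep a0, sep b0, sep a2, sep b2, sep a4, sep b4⟩
  have c0 : (0, 3) ∈ S (6, 0) :=
    (hS _ (by decide)).mem_of_cut u0 (0, 3)
      {x | x = 0 ∨ x = 4 ∨ x = 5 ∨ 6 < x} (by decide +kernel)
  have d0 : (3, 6) ∈ S (6, 0) :=
    (hS _ (by decide)).mem_of_cut u0 (3, 6)
      {x | x = 0 ∨ x = 3 ∨ x = 4 ∨ x = 5 ∨ 6 < x} (by decide +kernel)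
  have u2 : ∀ p ∈ ({(2, 3), (3, 4), (4, 5), (5, 6), (6, 7), (7, 8)} : Finset (Fin 13 × Fin 13)),
      p ∉ S (8, 2) := by
    simp only [Finset.forall_mem_insert, Finset.mem_singleton, forall_eq]
    exact ⟨sep a2, sep b2, sep a4, sep b4, sep a6, sep b6⟩
  have c2 : (2, 5) ∈ S (8, 2) :=
    (hS _ (by decide)).mem_of_cut u2 (2, 5)
      {x | x = 2 ∨ x = 6 ∨ x = 7 ∨ 8 < x} (by decide +kernel)
  have d2 : (5, 8) ∈ S (8, 2) :=
    (hS _ (by decide)).mem_of_cut u2 (5, 8)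
      {x | x = 2 ∨ x = 5 ∨ x = 6 ∨ x = 7 ∨ 8 < x} (by decide +kernel)
  have u4 : ∀ p ∈ ({(4, 5), (5, 6), (6, 7), (7, 8), (8, 9), (9, 10)} : Finset (Fin 13 × Fin 13)),
      p ∉ S (10, 4) := by
    simp only [Finset.forall_mem_insert, Finset.mem_singleton, forall_eq]
    exact ⟨sep a4, sep b4, sep a6, sep b6, sep a8, sep b8⟩
  have c4 : (4, 7) ∈ S (10, 4) :=
    (hS _ (by decide)).mem_of_cut u4 (4, 7)
      {x | x = 4 ∨ x = 8 ∨ x = 9 ∨ 10 < x} (by decide +kernel)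
  have d4 : (7, 10) ∈ S (10, 4) :=
    (hS _ (by decide)).mem_of_cut u4 (7, 10)
      {x | x = 4 ∨ x = 7 ∨ x = 8 ∨ x = 9 ∨ 10 < x} (by decide +kernel)
  have u6 : ∀ p ∈ ({(6, 7), (7, 8), (8, 9), (9, 10), (10, 11), (11, 12)} :
      Finset (Fin 13 × Fin 13)), p ∉ S (12, 6) := by
    simp only [Finset.forall_mem_insert, Finset.mem_singleton, forall_eq]
    exact ⟨sep a6, sep b6, sep a8, sep b8, sep a10, sep b10⟩
  have c6 : (6, 9) ∈ S (12, 6) :=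
    (hS _ (by decide)).mem_of_cut u6 (6, 9)
      {x | x = 6 ∨ x = 10 ∨ x = 11 ∨ 12 < x} (by decide +kernel)
  have d6 : (9, 12) ∈ S (12, 6) :=
    (hS _ (by decide)).mem_of_cut u6 (9, 12)
      {x | x = 6 ∨ x = 9 ∨ x = 10 ∨ x = 11 ∨ 12 < x} (by decide +kernel)
  have v : ∀ p ∈ ({(0, 1), (1, 2), (2, 3), (3, 4), (4, 5), (5, 6), (6, 7), (7, 8), (0, 3), (3, 6),
      (2, 5), (5, 8), (4, 7)} : Finset (Fin 13 × Fin 13)),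
      p ∉ S (8, 0) := by
    simp only [Finset.forall_mem_insert, Finset.mem_singleton, forall_eq]
    exact ⟨sep a0, sep b0, sep a2, sep b2, sep a4, sep b4, sep a6, sep b6, sep c0, sep d0, sep c2,
        sep d2, sep c4⟩
  have v' : (4, 8) ∈ S (8, 0) :=
    (hS _ (by decide)).mem_of_cut v (4, 8)
      {x | x = 0 ∨ x = 4 ∨ x = 5 ∨ x = 7 ∨ 8 < x} (by decide +kernel)
  have w : ∀ p ∈ ({(4, 5), (5, 6), (6, 7), (7, 8), (8, 9), (9, 10), (10, 11), (11, 12), (5, 8),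
      (4, 7), (7, 10), (6, 9), (9, 12)} : Finset (Fin 13 × Fin 13)),
      p ∉ S (12, 4) := by
    simp only [Finset.forall_mem_insert, Finset.mem_singleton, forall_eq]
    exact ⟨sep a4, sep b4, sep a6, sep b6, sep a8, sep b8, sep a10, sep b10, sep d2, sep c4,
        sep d4, sep c6, sep d6⟩
  have w' : (4, 8) ∈ S (12, 4) :=
    (hS _ (by decide)).mem_of_cut w (4, 8)
      {4, 9, 11} (by decide +kernel)
  exact sep v' (by decide) w'
end

section
/- Let T′ be the tournament on the vertex set Fin 13 = {0,…,12} defined as follows: for i < j the arc goes from i to j, except for the pairs B′ = {(2,0),(4,2),(6,4),(8,6),(10,8),(12,10),(6,0),(8,2),(10,4),(12,6),(8,0),(12,4),(12,2),(10,2),(10,0)}, for which the arc goes backward. Then τ(T′) = 15 and ν(T′) = 14; moreover the 15-element set B′ is a minimum feedback arc set of T′ and the digraph on Fin 13 with arc set B′ is acyclic and contains a directed Hamiltonian path through all of its non-isolated vertices. -/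
/-- `S` is a feedback arc set: a set of arcs whose removal leaves an acyclic digraph. -/
def IsFeedbackArcSet {V : Type*} (A : V → V → Prop) (S : Finset (V × V)) : Prop :=
  (∀ e ∈ S, A e.1 e.2) ∧
    ∀ c : List V, ¬ IsCycle (fun x y => A x y ∧ (x, y) ∉ S) c

/-- `τ(D)`: the minimum size of a feedback arc set. -/
noncomputable def tau {V : Type*} (A : V → V → Prop) : ℕ :=
  sInf {n | ∃ S : Finset (V × V), IsFeedbackArcSet A S ∧ S.card = n}

/-- `ν(D)`: the maximum number of pairwise arc-disjoint directed cycles. -/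
noncomputable def nu {V : Type*} [DecidableEq V] (A : V → V → Prop) : ℕ :=
  sSup {n | ∃ C : Fin n → List V, (∀ i, IsCycle A (C i)) ∧
    ∀ i j, i ≠ j → Disjoint (cycleArcs (C i)) (cycleArcs (C j))}

/-- The backward arcs of the tournament `T'` of Remark 1. -/
def B13' : Finset (Fin 13 × Fin 13) :=
  {(2,0),(4,2),(6,4),(8,6),(10,8),(12,10),(6,0),(8,2),(10,4),(12,6),(8,0),(12,4),
   (12,2),(10,2),(10,0)}

/-- The tournament `T'` of Remark 1: for `i < j` the arc goes from `i` to `j`,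
except for the pairs in `B13'`, for which the arc goes backward. -/
def T13' (i j : Fin 13) : Prop :=
  (i < j ∧ (j, i) ∉ B13') ∨ (i, j) ∈ B13'

theorem isChain_and_getLast_iff {V : Type*} (A : V → V → Prop) (l : List V) (x z : V) :
    (List.IsChain A (x :: l) ∧ A ((x :: l).getLast (List.cons_ne_nil x l)) z) ↔
      ∀ e ∈ (x :: l).zip (l ++ [z]), A e.1 e.2 := by
  induction l generalizing x with
  | nil => simp
  | cons y l ih =>
    have h := ih y
    simp only [List.cons_append, List.zip_cons_cons, List.forall_mem_cons,
      List.isChain_cons_cons, List.getLast_cons_cons] at h ⊢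
    rw [← h, and_assoc]

theorem isCycle_iff_forall_mem_cycleArcs {V : Type*} [DecidableEq V] (A : V → V → Prop)
    (c : List V) :
    IsCycle A c ↔ c.Nodup ∧ 3 ≤ c.length ∧ ∀ e ∈ cycleArcs c, A e.1 e.2 := by
  unfold IsCycle cycleArcs
  cases c with
  | nil => simp
  | cons x l =>
    simp only [List.mem_toFinset, List.rotate_cons_succ, List.rotate_zero,
      ← isChain_and_getLast_iff, List.head_cons]
    exact and_congr_right' (and_congr_right' (and_congr_right'
      ⟨fun h => h (List.cons_ne_nil x l), fun h _ => h⟩))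

theorem rel_of_forall_mem_zip {V : Type*} (R : V → V → Prop) [IsTrans V R] (l : List V) (x z : V)
    (h : ∀ e ∈ (x :: l).zip (l ++ [z]), R e.1 e.2) : R x z := by
  induction l generalizing x with
  | nil => simpa using h
  | cons y l ih =>
    simp only [List.cons_append, List.zip_cons_cons, List.forall_mem_cons] at h
    exact _root_.trans h.1 (ih y (by simpa using h.2))

theorem not_isCycle_of_forall_rel {V : Type*} (A R : V → V → Prop) [IsTrans V R]
    [Std.Irrefl R] (hAR : ∀ x y, A x y → R x y) (c : List V) : ¬ IsCycle A c := by
  classical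
  intro hc
  obtain ⟨-, hlen, harc⟩ := (isCycle_iff_forall_mem_cycleArcs A c).1 hc
  cases c with
  | nil => simp at hlen
  | cons x l =>
    refine irrefl_of R x (rel_of_forall_mem_zip R l x x fun e he => hAR _ _ (harc e ?_))
    simpa [cycleArcs] using he

/-- A function bounded on arcs by a weight and satisfying the triangle inequality bounds the
weight of every walk. -/
theorem le_sum_map_zip {V : Type*} (A : V → V → Prop) (w : V × V → ℕ) (d : V → V → ℕ)
    (hw : ∀ x y, A x y → d x y ≤ w (x, y)) (hd : ∀ x y z, d x z ≤ d x y + d y z)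
    (l : List V) (x z : V) (h : ∀ e ∈ (x :: l).zip (l ++ [z]), A e.1 e.2) :
    d x z ≤ (((x :: l).zip (l ++ [z])).map w).sum := by
  induction l generalizing x with
  | nil => simpa using hw x z (by simpa using h)
  | cons y l ih =>
    simp only [List.cons_append, List.zip_cons_cons, List.forall_mem_cons] at h
    have := ih y (by simpa using h.2)
    have := hw x y h.1
    have := hd x y z
    simp only [List.cons_append, List.zip_cons_cons, List.map_cons, List.sum_cons] at *
    omega

theorem nodup_zip_of_nodup {α β : Type*} (l : List α) (l' : List β) (h : l.Nodup) :
    (l.zip l').Nodup := by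
  refine List.Nodup.of_map Prod.fst ?_
  rw [List.zip_eq_zip_take_min, List.map_fst_zip (by simp)]
  exact h.sublist (List.take_sublist _ _)

theorem le_sum_cycleArcs {V : Type*} [DecidableEq V] (A : V → V → Prop) (w : V × V → ℕ)
    (d : V → V → ℕ) (k : ℕ) (hw : ∀ x y, A x y → d x y ≤ w (x, y))
    (hd : ∀ x y z, d x z ≤ d x y + d y z) (hk : ∀ x, k ≤ d x x) (c : List V)
    (hc : IsCycle A c) : k ≤ ∑ e ∈ cycleArcs c, w e := by
  obtain ⟨hnd, hlen, harc⟩ := (isCycle_iff_forall_mem_cycleArcs A c).1 hc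
  rw [cycleArcs, List.sum_toFinset w (nodup_zip_of_nodup _ _ hnd)]
  cases c with
  | nil => simp at hlen
  | cons x l =>
    simp only [cycleArcs, List.rotate_cons_succ, List.rotate_zero, List.mem_toFinset] at harc ⊢
    exact (hk x).trans (le_sum_map_zip A w d hw hd l x x harc)

/-- Weak duality between a fractional cycle cover and an arc-disjoint cycle packing. -/
theorem card_mul_le_sum_of_disjoint {V : Type*} [Fintype V] [DecidableEq V]
    (A : V → V → Prop) (w : V × V → ℕ) (k n : ℕ)
    (hw : ∀ c, IsCycle A c → k ≤ ∑ e ∈ cycleArcs c, w e)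
    (C : Fin n → List V) (hC : ∀ i, IsCycle A (C i))
    (hdisj : ∀ i j, i ≠ j → Disjoint (cycleArcs (C i)) (cycleArcs (C j))) :
    n * k ≤ ∑ e, w e := by
  calc n * k = ∑ _i : Fin n, k := by simp
    _ ≤ ∑ i, ∑ e ∈ cycleArcs (C i), w e := Finset.sum_le_sum fun i _ => hw _ (hC i)
    _ = ∑ e ∈ Finset.univ.biUnion fun i => cycleArcs (C i), w e :=
      (Finset.sum_biUnion fun i _ j _ hij => hdisj i j hij).symm
    _ ≤ ∑ e, w e := Finset.sum_le_sum_of_subset (Finset.subset_univ _)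

theorem IsFeedbackArcSet.exists_mem_cycleArcs {V : Type*} [DecidableEq V] {A : V → V → Prop}
    {S : Finset (V × V)} (hS : IsFeedbackArcSet A S) {c : List V} (hc : IsCycle A c) :
    ∃ e ∈ S, e ∈ cycleArcs c := by
  by_contra! h
  obtain ⟨hnd, hlen, harc⟩ := (isCycle_iff_forall_mem_cycleArcs A c).1 hc
  exact hS.2 c ((isCycle_iff_forall_mem_cycleArcs _ c).2
    ⟨hnd, hlen, fun e he => ⟨harc e he, fun heS => h e heS he⟩⟩)

/-- Weak duality between a feedback arc set and a fractional cycle packing. -/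
theorem IsFeedbackArcSet.sum_le_card_mul {V ι : Type*} [Fintype ι] [DecidableEq V]
    {A : V → V → Prop} {S : Finset (V × V)} (hS : IsFeedbackArcSet A S) (C : ι → List V)
    (m : ι → ℕ) (k : ℕ) (hC : ∀ i, IsCycle A (C i))
    (hk : ∀ e, ∑ i, (if e ∈ cycleArcs (C i) then m i else 0) ≤ k) :
    ∑ i, m i ≤ S.card * k := by
  calc ∑ i, m i ≤ ∑ i, ∑ e ∈ S, if e ∈ cycleArcs (C i) then m i else 0 := by
        refine Finset.sum_le_sum fun i _ => ?_
        obtain ⟨e, heS, he⟩ := hS.exists_mem_cycleArcs (hC i)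
        simpa [he] using Finset.single_le_sum
          (f := fun e => if e ∈ cycleArcs (C i) then m i else 0) (fun _ _ => Nat.zero_le _) heS
    _ = ∑ e ∈ S, ∑ i, if e ∈ cycleArcs (C i) then m i else 0 := Finset.sum_comm
    _ ≤ ∑ _e ∈ S, k := Finset.sum_le_sum fun e _ => hk e
    _ = S.card * k := by simp

instance : DecidableRel T13' := fun i j =>
  inferInstanceAs (Decidable ((i < j ∧ (j, i) ∉ B13') ∨ (i, j) ∈ B13'))

/-- Twice an optimal fractional cover of the cycles of `T13'`. -/
def coverWeight (e : Fin 13 × Fin 13) : ℕ :=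
  if e = (10, 2) then 2
  else if e ∈ ([(0, 1), (0, 3), (0, 5), (2, 0), (2, 3), (2, 5), (4, 2), (4, 5), (4, 8), (6, 0),
      (6, 4), (7, 8), (7, 10), (7, 12), (8, 0), (8, 2), (8, 6), (9, 10), (9, 12), (10, 0),
      (10, 4), (10, 8), (11, 12), (12, 2), (12, 4), (12, 6), (12, 10)] : List (Fin 13 × Fin 13)) then 1
  else 0

/-- The distances in `T13'` with respect to `coverWeight` along nontrivial walks,
truncated at `2`. -/
def coverDist : Fin 13 → Fin 13 → ℕ :=
  ![![2, 1, 1, 1, 0, 1, 1, 0, 1, 0, 1, 0, 0],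
    ![1, 2, 0, 0, 0, 0, 0, 0, 0, 0, 0, 0, 0],
    ![1, 2, 2, 1, 1, 1, 0, 0, 1, 0, 0, 0, 1],
    ![1, 2, 1, 2, 0, 0, 0, 0, 0, 0, 0, 0, 0],
    ![2, 2, 1, 2, 2, 1, 1, 0, 1, 0, 1, 0, 1],
    ![1, 2, 1, 2, 1, 2, 0, 0, 0, 0, 0, 0, 0],
    ![1, 2, 2, 2, 1, 2, 2, 0, 1, 0, 0, 0, 1],
    ![2, 2, 2, 2, 2, 2, 2, 2, 1, 0, 1, 0, 1],
    ![1, 2, 1, 2, 1, 2, 1, 1, 2, 0, 1, 0, 0],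
    ![2, 2, 2, 2, 2, 2, 2, 2, 2, 2, 1, 0, 1],
    ![1, 2, 2, 2, 1, 2, 2, 1, 1, 1, 2, 0, 1],
    ![2, 2, 2, 2, 2, 2, 2, 2, 2, 2, 2, 2, 1],
    ![2, 2, 1, 2, 1, 2, 1, 1, 2, 1, 1, 1, 2]]

/-- Fourteen arc-disjoint triangles of `T13'`. -/
def disjointTriangles : Fin 14 → List (Fin 13) :=
  ![[0, 1, 2], [0, 3, 6], [0, 4, 8], [0, 5, 10], [2, 3, 4], [2, 5, 12], [2, 6, 10],
    [2, 7, 8], [4, 5, 6], [4, 7, 10], [4, 9, 12], [6, 7, 12], [8, 9, 10], [10, 11, 12]]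

/-- The support of an optimal fractional packing of cycles of `T13'`. -/
def packingTriangles : Fin 26 → List (Fin 13) :=
  ![[1, 2, 0], [1, 8, 0], [3, 4, 2], [3, 6, 0], [3, 8, 2], [4, 2, 0], [4, 8, 0],
    [5, 6, 4], [5, 8, 0], [5, 8, 2], [5, 10, 0], [5, 12, 2], [6, 10, 2], [7, 8, 6],
    [7, 10, 0], [7, 10, 4], [7, 12, 2], [7, 12, 4], [8, 12, 4], [9, 10, 4], [9, 10, 8],
    [9, 12, 4], [9, 12, 6], [11, 12, 6], [11, 12, 10], [12, 10, 8]]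

/-- Four times the weights of an optimal fractional packing of cycles of `T13'`. -/
def packingWeight : Fin 26 → ℕ :=
  ![3, 1, 3, 4, 1, 1, 2, 4, 1, 3, 3, 1, 4, 4, 1, 3, 3, 1, 2, 1, 3, 1, 3, 1, 3, 1]

theorem two_le_sum_coverWeight (c : List (Fin 13)) (hc : IsCycle T13' c) :
    2 ≤ ∑ e ∈ cycleArcs c, coverWeight e :=
  le_sum_cycleArcs T13' coverWeight coverDist 2 (by decide +kernel) (by decide +kernel)
    (by decide +kernel) c hc

theorem isCycle_disjointTriangles (i : Fin 14) : IsCycle T13' (disjointTriangles i) := by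
  rw [isCycle_iff_forall_mem_cycleArcs]
  revert i
  decide +kernel

theorem isCycle_packingTriangles (i : Fin 26) : IsCycle T13' (packingTriangles i) := by
  rw [isCycle_iff_forall_mem_cycleArcs]
  revert i
  decide +kernel

theorem nu_T13' : nu T13' = 14 := by
  refine IsGreatest.csSup_eq ⟨⟨disjointTriangles, isCycle_disjointTriangles, by decide +kernel⟩, ?_⟩
  rintro n ⟨C, hC, hdisj⟩
  have h := card_mul_le_sum_of_disjoint T13' coverWeight 2 n two_le_sum_coverWeight C hC hdisj
  have hsum : ∑ e, coverWeight e = 29 := by decide +kernel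
  omega

theorem isFeedbackArcSet_B13' : IsFeedbackArcSet T13' B13' := by
  refine ⟨fun e he => Or.inr he, not_isCycle_of_forall_rel _ (· < ·) ?_⟩
  rintro x y ⟨h | h, hn⟩
  · exact h.1
  · exact absurd h hn

theorem card_B13' : B13'.card = 15 := by decide

theorem tau_T13' : tau T13' = 15 := by
  refine IsLeast.csInf_eq ⟨⟨B13', isFeedbackArcSet_B13', card_B13'⟩, ?_⟩
  rintro n ⟨S, hS, rfl⟩
  have h := hS.sum_le_card_mul packingTriangles packingWeight 4 isCycle_packingTriangles
    (by decide +kernel)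
  have hsum : ∑ i, packingWeight i = 58 := by decide +kernel
  omega

/-- Remark 1: `τ(T') = 15` and `ν(T') = 14`; the 15-element set `B13'` is a
minimum feedback arc set of `T'`, the digraph on `Fin 13` with arc set `B13'` is
acyclic, and it has a directed Hamiltonian path through all of its non-isolated
vertices. -/
theorem remark1_T13' :
    tau T13' = 15 ∧ nu T13' = 14 ∧
    IsFeedbackArcSet T13' B13' ∧ B13'.card = 15 ∧
    (∀ c : List (Fin 13), ¬ IsCycle (fun x y : Fin 13 => (x, y) ∈ B13') c) ∧
    (∃ p : List (Fin 13), p.Nodup ∧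
      List.Chain' (fun x y : Fin 13 => (x, y) ∈ B13') p ∧
      ∀ v : Fin 13, ((∃ e ∈ B13', e.1 = v ∨ e.2 = v) ↔ v ∈ p)) := by
  refine ⟨tau_T13', nu_T13', isFeedbackArcSet_B13', card_B13', ?_,
    [12, 10, 8, 6, 4, 2, 0], by decide, ?_, by decide⟩
  · exact not_isCycle_of_forall_rel _ (· > ·) (by decide)
  · rw [List.Chain']
    decide
end
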